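/- Symplectic Poisson summation formula in dimension 2: let f : ℝ² → ℂ be a Schwartz function, M ∈ GL(2,ℝ), Λ = Mℤ², and Λ° = JM^{−T}ℤ² the adjoint lattice, where J = [[0,1],[−1,0]]. Then for every z ∈ ℝ²: Σ_{λ∈Λ} f(λ + z) = |det M|^{−1} Σ_{μ∈Λ°} F_σ f(μ) e^{2πi σ(μ, z)}, where σ((x,ω),(x',ω')) = xω' − ωx' is the standard symplectic form and F_σ f(z) = ∫_{ℝ²} f(z') e^{−2πi σ(z,z')} dz' is the symplectic Fourier transform; both sides converge absolutely. -/

import Mathlib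

noncomputable section
open MeasureTheory

/-- The standard symplectic form on `ℝ²`: `σ((x,ω),(x',ω')) = xω' − ωx'`. -/
def sympForm (z w : ℝ × ℝ) : ℝ := z.1 * w.2 - z.2 * w.1

/-- The symplectic Fourier transform `F_σ f(z) = ∫_{ℝ²} f(z') e^{−2πi σ(z,z')} dz'`. -/
def sympFourier (f : ℝ × ℝ → ℂ) (z : ℝ × ℝ) : ℂ :=
  ∫ w : ℝ × ℝ, f w * Complex.exp (-(2 * (Real.pi : ℂ) * Complex.I * (sympForm z w : ℂ)))

/-- The standard symplectic matrix `J = [[0,1],[-1,0]]`. -/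
def Jmat : Matrix (Fin 2) (Fin 2) ℝ := !![0, 1; -1, 0]

/-- The point of the lattice `Mℤ²` indexed by `n ∈ ℤ²`. -/
def latticePt (M : Matrix (Fin 2) (Fin 2) ℝ) (n : ℤ × ℤ) : ℝ × ℝ :=
  (M.mulVec ![(n.1 : ℝ), (n.2 : ℝ)] 0, M.mulVec ![(n.1 : ℝ), (n.2 : ℝ)] 1)

/-- The point of the adjoint lattice `Λ° = J M^{-T} ℤ²` indexed by `n ∈ ℤ²`. -/
def adjointPt (M : Matrix (Fin 2) (Fin 2) ℝ) (n : ℤ × ℤ) : ℝ × ℝ :=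
  latticePt (Jmat * (M⁻¹).transpose) n

/-- The negative powers of `1 + ‖n‖` are summable over `ℤᵈ` once the exponent exceeds `d`. -/
theorem summable_inv_one_add_norm_intCast_pow {d : Type*} [Fintype d] {k : ℕ}
    (hk : Fintype.card d < k) :
    Summable fun n : d → ℤ => ((1 + ‖fun i => (n i : ℝ)‖) ^ k)⁻¹ := by
  classical
  set L := Submodule.span ℤ (Set.range (Pi.basisFun ℝ d)) with hL
  have hrank : Module.finrank ℤ L < k := by
    rw [ZLattice.rank ℝ L]; simpa using hk
  have hmem : ∀ n : d → ℤ, (fun i => (n i : ℝ)) ∈ L := fun n => by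
    rw [hL, Module.Basis.mem_span_iff_repr_mem]
    intro i
    simp
  have hinj : Function.Injective fun n : d → ℤ => (⟨fun i => (n i : ℝ), hmem n⟩ : L) := by
    intro m n h
    funext i
    simpa using congrFun (congrArg Subtype.val h) i
  have hsum := (ZLattice.summable_norm_pow_inv L k hrank).comp_injective hinj
  refine hsum.of_norm_bounded_eventually ?_
  filter_upwards [(Set.finite_singleton (0 : d → ℤ)).compl_mem_cofinite] with n hn
  have hpos : 0 < ‖fun i => (n i : ℝ)‖ := by
    refine norm_pos_iff.2 fun h => hn ?_
    funext i
    simpa using congrFun h i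
  rw [Real.norm_of_nonneg (by positivity)]
  simp only [Function.comp_apply, ← inv_pow]
  gcongr
  exact le_add_of_nonneg_left zero_le_one

/-- A Schwartz function decays uniformly along the translates of `ℤᵈ` by points of a bounded set. -/
theorem SchwartzMap.exists_norm_add_intCast_le {d E : Type*} [Fintype d] [NormedAddCommGroup E]
    [NormedSpace ℝ E] (f : SchwartzMap (d → ℝ) E) (k : ℕ) :
    ∃ C, 0 ≤ C ∧ ∀ (x : d → ℝ) (n : d → ℤ),
      ‖f (x + fun i => (n i : ℝ))‖ ≤ C * (1 + ‖x‖) ^ k * ((1 + ‖fun i => (n i : ℝ)‖) ^ k)⁻¹ := by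
  have hf := one_add_le_sup_seminorm_apply (𝕜 := ℝ) (m := (k, 0)) (k := k) (n := 0)
    le_rfl le_rfl f
  simp only [norm_iteratedFDeriv_zero] at hf
  refine ⟨_, (by positivity : (0 : ℝ) ≤ _).trans (hf 0), fun x n => ?_⟩
  set v : d → ℝ := fun i => (n i : ℝ)
  have hv : 1 + ‖v‖ ≤ (1 + ‖x + v‖) * (1 + ‖x‖) := by
    have : ‖v‖ ≤ ‖x + v‖ + ‖x‖ := by simpa using norm_sub_le (x + v) x
    nlinarith [norm_nonneg (x + v), norm_nonneg x]
  rw [← div_eq_mul_inv, le_div_iff₀ (by positivity)]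
  calc ‖f (x + v)‖ * (1 + ‖v‖) ^ k
      ≤ ‖f (x + v)‖ * ((1 + ‖x + v‖) * (1 + ‖x‖)) ^ k := by gcongr
    _ = ((1 + ‖x + v‖) ^ k * ‖f (x + v)‖) * (1 + ‖x‖) ^ k := by rw [mul_pow]; ring
    _ ≤ _ := mul_le_mul_of_nonneg_right (hf _) (by positivity)

/-- A Schwartz function is absolutely summable along every translate of `ℤᵈ`. -/
theorem SchwartzMap.summable_norm_add_intCast {d E : Type*} [Fintype d] [NormedAddCommGroup E]
    [NormedSpace ℝ E] (f : SchwartzMap (d → ℝ) E) (x : d → ℝ) :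
    Summable fun n : d → ℤ => ‖f (x + fun i => (n i : ℝ))‖ := by
  obtain ⟨C, -, hC⟩ := f.exists_norm_add_intCast_le (Fintype.card d + 1)
  exact ((summable_inv_one_add_norm_intCast_pow (Nat.lt_succ_self _)).mul_left _).of_nonneg_of_le
    (fun _ => norm_nonneg _) (hC x)

/-- The periodization of a Schwartz function over `ℤᵈ` is continuous. -/
theorem SchwartzMap.continuous_tsum_add_intCast {d E : Type*} [Fintype d] [NormedAddCommGroup E]
    [NormedSpace ℝ E] [CompleteSpace E] (f : SchwartzMap (d → ℝ) E) :
    Continuous fun x : d → ℝ => ∑' n : d → ℤ, f (x + fun i => (n i : ℝ)) := by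
  obtain ⟨C, hC0, hC⟩ := f.exists_norm_add_intCast_le (Fintype.card d + 1)
  refine continuous_iff_continuousAt.2 fun x₀ => ?_
  have hon : ContinuousOn (fun x : d → ℝ => ∑' n : d → ℤ, f (x + fun i => (n i : ℝ)))
      (Metric.ball 0 (‖x₀‖ + 1)) := by
    refine continuousOn_tsum
      (fun n => (f.continuous.comp (continuous_add_const _)).continuousOn)
      ((summable_inv_one_add_norm_intCast_pow (d := d) (Nat.lt_succ_self _)).mul_left
        (C * (1 + (‖x₀‖ + 1)) ^ (Fintype.card d + 1))) fun n x hx => (hC x n).trans ?_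
    have : ‖x‖ ≤ ‖x₀‖ + 1 := (mem_ball_zero_iff.1 hx).le
    gcongr
  exact hon.continuousAt (Metric.isOpen_ball.mem_nhds (by simp))

/-- The integral over `ℝᵈ` is the sum over `ℤᵈ` of the integrals of the translates over the unit
cube. -/
theorem hasSum_setIntegral_unitCube_add_intCast {d E : Type*} [Fintype d] [NormedAddCommGroup E]
    [NormedSpace ℝ E] {f : (d → ℝ) → E} (hf : Integrable f) :
    HasSum (fun n : d → ℤ => ∫ x in {x : d → ℝ | ∀ i, x i ∈ Set.Ioc (0 : ℝ) (0 + 1)},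
      f (x + fun i => (n i : ℝ))) (∫ x, f x) := by
  let S : (d → ℤ) → Set (d → ℝ) := fun n => Set.univ.pi fun i => Set.Ioc (0 + n i : ℝ) (0 + n i + 1)
  have hmeas : ∀ n, MeasurableSet (S n) := fun n =>
    MeasurableSet.univ_pi fun i => measurableSet_Ioc
  have hdisj : Pairwise (Function.onFun Disjoint S) := by
    intro m n hmn
    obtain ⟨i, hi⟩ := Function.ne_iff.1 hmn
    exact Set.disjoint_univ_pi.2 ⟨i, Set.pairwise_disjoint_Ioc_add_intCast (0 : ℝ) hi⟩
  have hunion : ⋃ n, S n = Set.univ := by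
    refine Set.eq_univ_of_forall fun x => ?_
    have h : ∀ i, ∃ n : ℤ, x i ∈ Set.Ioc (0 + n : ℝ) (0 + n + 1) := fun i =>
      Set.mem_iUnion.1 (iUnion_Ioc_add_intCast (0 : ℝ) ▸ Set.mem_univ (x i))
    choose n hn using h
    exact Set.mem_iUnion.2 ⟨n, fun i _ => hn i⟩
  have hsum := hasSum_integral_iUnion hmeas hdisj (f := f) (μ := volume) hf.integrableOn
  rw [hunion, setIntegral_univ] at hsum
  refine hsum.congr_fun fun n => ?_
  have hpre : (fun x => x + fun i => (n i : ℝ)) ⁻¹' S n =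
      {x : d → ℝ | ∀ i, x i ∈ Set.Ioc (0 : ℝ) (0 + 1)} := by
    ext x
    simp [S, add_comm _ (1 : ℝ)]
  rw [← hpre]
  exact (measurePreserving_add_right volume fun i => (n i : ℝ)).setIntegral_preimage_emb
    (measurableEmbedding_addRight _) f (S n)

theorem UnitAddTorus.mFourier_coe_eq_exp {d : Type*} [Fintype d] (n : d → ℤ) (x : d → ℝ) :
    UnitAddTorus.mFourier n (fun i => (x i : UnitAddCircle)) =
      Complex.exp (2 * (Real.pi : ℂ) * Complex.I * (((fun i => (n i : ℝ)) ⬝ᵥ x : ℝ) : ℂ)) := by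
  simp only [UnitAddTorus.mFourier, ContinuousMap.coe_mk, fourier_coe_apply, dotProduct]
  rw [← Complex.exp_sum]
  congr 1
  push_cast
  rw [Finset.mul_sum]
  refine Finset.sum_congr rfl fun i _ => ?_
  ring

/-- The Fourier transform of a Schwartz function on `ℝᵈ` is absolutely summable over `ℤᵈ`. -/
theorem SchwartzMap.summable_integral_mFourier {d : Type*} [Fintype d]
    (f : SchwartzMap (d → ℝ) ℂ) :
    Summable fun n : d → ℤ =>
      ∫ x : d → ℝ, UnitAddTorus.mFourier (-n) (fun i => (x i : UnitAddCircle)) * f x := by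
  let e : EuclideanSpace ℝ d ≃L[ℝ] (d → ℝ) := EuclideanSpace.equiv d ℝ
  let g : SchwartzMap (EuclideanSpace ℝ d) ℂ := compCLMOfContinuousLinearEquiv ℝ e f
  let h : SchwartzMap (d → ℝ) ℂ :=
    compCLMOfContinuousLinearEquiv ℝ e.symm (FourierTransform.fourier g)
  refine (h.summable_norm_add_intCast 0).of_norm.congr fun n => ?_
  have hh : h (0 + fun i => (n i : ℝ)) =
      FourierTransform.fourier (g : EuclideanSpace ℝ d → ℂ) (WithLp.toLp 2 fun i => (n i : ℝ)) := by
    rw [zero_add]; rfl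
  rw [hh, Real.fourier_eq', ← (PiLp.volume_preserving_toLp d).integral_comp
    (MeasurableEquiv.toLp 2 (d → ℝ)).measurableEmbedding]
  refine integral_congr_ae (.of_forall fun x => ?_)
  have hgx : g (WithLp.toLp 2 x) = f x := rfl
  simp only [hgx, smul_eq_mul, UnitAddTorus.mFourier_coe_eq_exp,
    EuclideanSpace.inner_toLp_toLp]
  congr 2
  simp [dotProduct]
  ring

/-- The Fourier coefficients of the periodization of a Schwartz function are the values of its
Fourier transform at the integer points. -/
theorem SchwartzMap.setIntegral_mFourier_mul_tsum {d : Type*} [Fintype d]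
    (f : SchwartzMap (d → ℝ) ℂ) (m : d → ℤ) :
    ∫ x in {x : d → ℝ | ∀ i, x i ∈ Set.Ioc (0 : ℝ) (0 + 1)},
      UnitAddTorus.mFourier m (fun i => (x i : UnitAddCircle)) *
        ∑' n : d → ℤ, f (x + fun i => (n i : ℝ)) =
    ∫ x : d → ℝ, UnitAddTorus.mFourier m (fun i => (x i : UnitAddCircle)) * f x := by
  let e : (d → ℝ) → ℂ := fun x => UnitAddTorus.mFourier m (fun i => (x i : UnitAddCircle))
  have he : Continuous e := by
    refine (UnitAddTorus.mFourier m).continuous.comp (continuous_pi fun i => ?_)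
    exact (AddCircle.continuous_mk' 1).comp (continuous_apply i)
  have henorm : ∀ x, ‖e x‖ = 1 := fun x => by
    simp only [e, UnitAddTorus.mFourier_coe_eq_exp]
    rw [Complex.norm_exp]
    simp
  have heper : ∀ x (n : d → ℤ), e (x + fun i => (n i : ℝ)) = e x := fun x n => by
    simp only [e]
    congr 1
    funext i
    simp
  have hint : Integrable fun x => e x * f x :=
    f.integrable.bdd_mul he.aestronglyMeasurable (.of_forall fun x => (henorm x).le)
  have hint_norm : Integrable fun x => ‖f x‖ := f.integrable.norm
  have hsum := hasSum_setIntegral_unitCube_add_intCast hint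
  have hsum_norm := hasSum_setIntegral_unitCube_add_intCast hint_norm
  simp only [heper] at hsum
  change _ = ∫ x, e x * f x
  rw [← hsum.tsum_eq, integral_tsum_of_summable_integral_norm]
  · exact integral_congr_ae (.of_forall fun x => tsum_mul_left.symm)
  · intro n
    have h := hint.comp_add_right fun i => (n i : ℝ)
    simp only [heper] at h
    exact h.integrableOn
  · simpa only [norm_mul, henorm, one_mul] using hsum_norm.summable

/-- **Poisson summation formula** for Schwartz functions on `ℝᵈ` and the lattice `ℤᵈ`. -/
theorem SchwartzMap.tsum_add_intCast_eq_tsum_integral {d : Type*} [Fintype d]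
    (f : SchwartzMap (d → ℝ) ℂ) (x : d → ℝ) :
    ∑' n : d → ℤ, f (x + fun i => (n i : ℝ)) = ∑' n : d → ℤ,
      (∫ y : d → ℝ, UnitAddTorus.mFourier (-n) (fun i => (y i : UnitAddCircle)) * f y) *
        UnitAddTorus.mFourier n (fun i => (x i : UnitAddCircle)) := by
  let q : (d → ℝ) → UnitAddTorus d := Pi.map fun _ (t : ℝ) => (t : UnitAddCircle)
  have hq : IsOpenQuotientMap q := .piMap fun _ => QuotientAddGroup.isOpenQuotientMap_mk
  let p : (d → ℝ) → ℂ := fun x => ∑' n : d → ℤ, f (x + fun i => (n i : ℝ))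
  have hp : ∀ ⦃x y⦄, q x = q y → p x = p y := by
    intro x y hxy
    have h : ∀ i, ∃ k : ℤ, y i = x i + k := fun i => by
      have hi : (y i : UnitAddCircle) = x i := (congrFun hxy i).symm
      rw [← sub_eq_zero, ← AddCircle.coe_sub, AddCircle.coe_eq_zero_iff] at hi
      obtain ⟨k, hk⟩ := hi
      exact ⟨k, by rw [zsmul_one] at hk; linarith⟩
    choose k hk using h
    have hy : y = x + fun i => (k i : ℝ) := funext hk
    simp only [p]
    rw [← (Equiv.addRight k).tsum_eq, hy]
    refine tsum_congr fun n => congrArg f ?_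
    funext i
    simp
    ring
  let F : C(UnitAddTorus d, ℂ) :=
    Topology.IsQuotientMap.lift (f := (⟨q, hq.continuous⟩ : C(d → ℝ, UnitAddTorus d)))
      hq.isQuotientMap ⟨p, f.continuous_tsum_add_intCast⟩ hp
  have hF : ∀ x, F (q x) = p x := fun x =>
    DFunLike.congr_fun (Topology.IsQuotientMap.lift_comp (f := ⟨q, hq.continuous⟩)
      hq.isQuotientMap ⟨p, f.continuous_tsum_add_intCast⟩ hp) x
  have hcoeff : ∀ n, UnitAddTorus.mFourierCoeff F n =
      ∫ y : d → ℝ, UnitAddTorus.mFourier (-n) (fun i => (y i : UnitAddCircle)) * f y := fun n => by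
    rw [UnitAddTorus.mFourierCoeff_eq_integral F n 0, ← f.setIntegral_mFourier_mul_tsum]
    refine integral_congr_ae (.of_forall fun x => ?_)
    exact congrArg (_ * ·) (hF x)
  have hsum : Summable (UnitAddTorus.mFourierCoeff F) :=
    f.summable_integral_mFourier.congr fun n => (hcoeff n).symm
  have := (UnitAddTorus.hasSum_mFourier_series_apply_of_summable hsum (q x)).tsum_eq
  simp only [hcoeff, hF, smul_eq_mul] at this
  exact this.symm

/-- The invertible real matrix `M`, as a continuous linear equivalence from `Fin 2 → ℝ` to
`ℝ × ℝ`. -/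
def matrixProdEquiv (M : Matrix (Fin 2) (Fin 2) ℝ) (hM : IsUnit M.det) :
    (Fin 2 → ℝ) ≃L[ℝ] ℝ × ℝ :=
  (M.toLinearEquiv' (M.invertibleOfIsUnitDet hM)).toContinuousLinearEquiv.trans
    (ContinuousLinearEquiv.finTwoArrow ℝ ℝ)

theorem matrixProdEquiv_apply (M : Matrix (Fin 2) (Fin 2) ℝ) (hM : IsUnit M.det)
    (x : Fin 2 → ℝ) : matrixProdEquiv M hM x = (M.mulVec x 0, M.mulVec x 1) := rfl

theorem integral_comp_matrixProdEquiv {E : Type*} [NormedAddCommGroup E] [NormedSpace ℝ E]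
    (M : Matrix (Fin 2) (Fin 2) ℝ) (hM : IsUnit M.det) (G : ℝ × ℝ → E) :
    ∫ x, G (matrixProdEquiv M hM x) = |M.det|⁻¹ • ∫ w, G w := by
  have hdet : M.det ≠ 0 := hM.ne_zero
  let e := (M.toLinearEquiv' (M.invertibleOfIsUnitDet hM)).toContinuousLinearEquiv
  have hcomp := e.toHomeomorph.measurableEmbedding.integral_map (μ := volume)
    fun v => G (MeasurableEquiv.finTwoArrow v)
  have hmap : Measure.map e.toHomeomorph volume = ENNReal.ofReal |M.det⁻¹| • volume :=
    Real.map_matrix_volume_pi_eq_smul_volume_pi hdet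
  rw [hmap, integral_smul_measure, (volume_preserving_finTwoArrow ℝ).integral_comp
    MeasurableEquiv.finTwoArrow.measurableEmbedding G, ENNReal.toReal_ofReal (abs_nonneg _),
    abs_inv] at hcomp
  exact hcomp.symm

theorem sympForm_adjointPt_matrixProdEquiv (M : Matrix (Fin 2) (Fin 2) ℝ) (hM : IsUnit M.det)
    (n : ℤ × ℤ) (x : Fin 2 → ℝ) :
    sympForm (adjointPt M n) (matrixProdEquiv M hM x) = ![(n.1 : ℝ), (n.2 : ℝ)] ⬝ᵥ x := by
  have h (w : Fin 2 → ℝ) : sympForm (adjointPt M n) (w 0, w 1) =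
      ![(n.1 : ℝ), (n.2 : ℝ)] ⬝ᵥ M⁻¹.mulVec w := by
    simp [sympForm, adjointPt, latticePt, Jmat, Matrix.mulVec, dotProduct, Matrix.mul_apply,
      Fin.sum_univ_two]
    ring
  rw [matrixProdEquiv_apply, h, Matrix.mulVec_mulVec, Matrix.nonsing_inv_mul M hM,
    Matrix.one_mulVec]

theorem intCast_finTwoArrowEquiv_symm (n : ℤ × ℤ) :
    (fun i => (((finTwoArrowEquiv ℤ).symm n i : ℤ) : ℝ)) = ![(n.1 : ℝ), (n.2 : ℝ)] := by
  funext i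
  fin_cases i <;> rfl

/-- The Fourier transform of `f ∘ M` at `n` is the symplectic Fourier transform of `f` at
`J M⁻ᵀ n`, up to the factor `|det M|⁻¹`. -/
theorem integral_mFourier_mul_comp_matrixProdEquiv (f : ℝ × ℝ → ℂ)
    (M : Matrix (Fin 2) (Fin 2) ℝ) (hM : IsUnit M.det) (n : ℤ × ℤ) :
    ∫ y, UnitAddTorus.mFourier (-(finTwoArrowEquiv ℤ).symm n)
        (fun i => (y i : UnitAddCircle)) * f (matrixProdEquiv M hM y) =
      ((|M.det|⁻¹ : ℝ) : ℂ) * sympFourier f (adjointPt M n) := by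
  rw [← Complex.real_smul, sympFourier, ← integral_comp_matrixProdEquiv M hM]
  refine integral_congr_ae (.of_forall fun y => ?_)
  have hneg : (fun i => (((-(finTwoArrowEquiv ℤ).symm n) i : ℤ) : ℝ)) =
      -![(n.1 : ℝ), (n.2 : ℝ)] := by
    rw [← intCast_finTwoArrowEquiv_symm]
    funext i
    simp
  simp only [UnitAddTorus.mFourier_coe_eq_exp, sympForm_adjointPt_matrixProdEquiv, hneg,
    neg_dotProduct, Complex.ofReal_neg, mul_neg]
  exact mul_comm _ _

/-- symplectic Poisson summation formula in dimension 2: for a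
Schwartz function `f` on `ℝ²`, a lattice `Λ = Mℤ²` with adjoint `Λ° = JM^{-T}ℤ²`,
and every `z ∈ ℝ²`,
`Σ_{λ∈Λ} f(λ+z) = |det M|⁻¹ Σ_{μ∈Λ°} F_σ f(μ) e^{2πi σ(μ,z)}`,
both sides converging absolutely. -/
theorem symplectic_poisson_summation
    (f : SchwartzMap (ℝ × ℝ) ℂ) (M : Matrix (Fin 2) (Fin 2) ℝ) (hM : IsUnit M.det)
    (z : ℝ × ℝ) :
    Summable (fun n : ℤ × ℤ => ‖f (latticePt M n + z)‖) ∧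
    Summable (fun n : ℤ × ℤ =>
      ‖sympFourier (fun w => f w) (adjointPt M n) *
        Complex.exp (2 * (Real.pi : ℂ) * Complex.I *
          (sympForm (adjointPt M n) z : ℂ))‖) ∧
    ∑' n : ℤ × ℤ, f (latticePt M n + z) =
      ((|M.det|⁻¹ : ℝ) : ℂ) * ∑' n : ℤ × ℤ,
        sympFourier (fun w => f w) (adjointPt M n) *
          Complex.exp (2 * (Real.pi : ℂ) * Complex.I *
            (sympForm (adjointPt M n) z : ℂ)) := by
  let A := matrixProdEquiv M hM
  let g : SchwartzMap (Fin 2 → ℝ) ℂ := SchwartzMap.compCLMOfContinuousLinearEquiv ℝ A f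
  let x := A.symm z
  have hz : A x = z := A.apply_symm_apply z
  have hg (n : ℤ × ℤ) :
      g (x + fun i => (((finTwoArrowEquiv ℤ).symm n i : ℤ) : ℝ)) = f (latticePt M n + z) := by
    change f (A _) = _
    rw [map_add, hz, intCast_finTwoArrowEquiv_symm, add_comm]
    rfl
  have hcoeff (n : ℤ × ℤ) :
      _ = ((|M.det|⁻¹ : ℝ) : ℂ) * sympFourier (fun w => f w) (adjointPt M n) :=
    integral_mFourier_mul_comp_matrixProdEquiv f M hM n
  have hexp (n : ℤ × ℤ) : UnitAddTorus.mFourier ((finTwoArrowEquiv ℤ).symm n)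
      (fun i => (x i : UnitAddCircle)) =
      Complex.exp (2 * (Real.pi : ℂ) * Complex.I * (sympForm (adjointPt M n) z : ℂ)) := by
    rw [UnitAddTorus.mFourier_coe_eq_exp, intCast_finTwoArrowEquiv_symm, ← hz,
      sympForm_adjointPt_matrixProdEquiv]
  have hdet : ((|M.det|⁻¹ : ℝ) : ℂ) ≠ 0 := by simpa using hM.ne_zero
  refine ⟨?_, ?_, ?_⟩
  · exact ((g.summable_norm_add_intCast x).comp_injective
      (finTwoArrowEquiv ℤ).symm.injective).congr fun n => congrArg norm (hg n)
  · have hsum := (g.summable_integral_mFourier.comp_injective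
      (finTwoArrowEquiv ℤ).symm.injective).congr hcoeff
    refine ((summable_mul_left_iff hdet).1 hsum).norm.congr fun n => ?_
    rw [norm_mul, Complex.norm_exp]
    simp
  · have hpoisson := g.tsum_add_intCast_eq_tsum_integral x
    rw [← (finTwoArrowEquiv ℤ).symm.tsum_eq, ← (finTwoArrowEquiv ℤ).symm.tsum_eq] at hpoisson
    rw [← tsum_mul_left]
    refine (tsum_congr fun n => (hg n).symm).trans (hpoisson.trans (tsum_congr fun n => ?_))
    rw [hexp, ← mul_assoc, ← hcoeff]
    rfl

end
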